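/- For every integer k ≥ 5, the space Z^k(T̂) of divergence-free polynomial vector fields of total degree at most k vanishing on the boundary of the reference triangle satisfies Z^k(T̂) = {curl(ψ b²) : ψ ∈ P^{k−5}}; that is, a pair of polynomials (v₁,v₂) of total degree at most k vanishes on ∂T̂ and satisfies ∂₁v₁ + ∂₂v₂ = 0 identically if and only if v₁ = ∂₂(ψ b²) and v₂ = −∂₁(ψ b²) for some polynomial ψ of total degree at most k−5. -/

import Mathlib

open MvPolynomial

/-- The cubic bubble `b(x,y) = xy(1−x−y)` of the reference triangle. -/
noncomputable def bubble : MvPolynomial (Fin 2) ℝ := X 0 * X 1 * (1 - X 0 - X 1)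

/-- `(x,y)` lies on the boundary of the reference triangle. -/
def OnBdryT (x y : ℝ) : Prop :=
  0 ≤ x ∧ 0 ≤ y ∧ x + y ≤ 1 ∧ (x = 0 ∨ y = 0 ∨ x + y = 1)

namespace MvPolynomial

/-- The formal antiderivative of a polynomial with respect to the `i`-th variable. -/
noncomputable def antideriv {σ : Type*} (i : σ) :
    MvPolynomial σ ℝ →ₗ[ℝ] MvPolynomial σ ℝ :=
  (basisMonomials σ ℝ).constr ℝ fun m => monomial (m + Finsupp.single i 1) ((m i + 1 : ℝ)⁻¹)

theorem antideriv_monomial {σ : Type*} (i : σ) (m : σ →₀ ℕ) (a : ℝ) :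
    antideriv i (monomial m a) = monomial (m + Finsupp.single i 1) (a * (m i + 1 : ℝ)⁻¹) := by
  have h : antideriv i (monomial m 1) =
      monomial (m + Finsupp.single i 1) ((m i + 1 : ℝ)⁻¹) := by
    simpa [antideriv] using (basisMonomials σ ℝ).constr_basis ℝ
      (fun m => monomial (m + Finsupp.single i 1) ((m i + 1 : ℝ)⁻¹)) m
  have h' : monomial m a = a • monomial m (1 : ℝ) := by simp [smul_monomial]
  rw [h', map_smul, h, smul_monomial, smul_eq_mul]

theorem pderiv_antideriv {σ : Type*} (i : σ) (p : MvPolynomial σ ℝ) :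
    pderiv i (antideriv i p) = p := by
  induction p using MvPolynomial.induction_on' with
  | monomial m a =>
    have h : (m i + 1 : ℝ) ≠ 0 := by positivity
    simp [antideriv_monomial, pderiv_monomial, h]
  | add p q hp hq => simp [hp, hq]

theorem pderiv_antideriv_of_ne {σ : Type*} {i j : σ} (hij : i ≠ j) (p : MvPolynomial σ ℝ) :
    pderiv i (antideriv j p) = antideriv j (pderiv i p) := by
  induction p using MvPolynomial.induction_on' with
  | monomial m a =>
    rw [antideriv_monomial, pderiv_monomial, pderiv_monomial, antideriv_monomial]
    rcases Nat.eq_zero_or_pos (m i) with h0 | h0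
    · simp [h0, hij]
    congr 1
    · congr 1
      ext l
      by_cases hl : l = i
      · subst hl; simp [hij]
      · simp [Ne.symm hl]
    · simp [hij, Ne.symm hij]
      ring
  | add p q hp hq => simp [hp, hq]

theorem pderiv_comm {σ R : Type*} [CommRing R] (i j : σ) (p : MvPolynomial σ R) :
    pderiv i (pderiv j p) = pderiv j (pderiv i p) := by
  have h : ⁅(pderiv i : Derivation R (MvPolynomial σ R) (MvPolynomial σ R)),
      (pderiv j : Derivation R (MvPolynomial σ R) (MvPolynomial σ R))⁆ = 0 := by
    refine derivation_ext fun l => ?_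
    classical
    simp [Derivation.commutator_apply, pderiv_X, Pi.single_apply, apply_ite]
  simpa [Derivation.commutator_apply, sub_eq_zero] using DFunLike.congr_fun h p

/-- A divergence-free polynomial field in the plane has a polynomial stream function. -/
theorem exists_streamFunction {v₁ v₂ : MvPolynomial (Fin 2) ℝ}
    (h : pderiv 0 v₁ + pderiv 1 v₂ = 0) :
    ∃ φ : MvPolynomial (Fin 2) ℝ, pderiv 1 φ = v₁ ∧ pderiv 0 φ = -v₂ := by
  refine ⟨antideriv 1 v₁ + antideriv 0 (-v₂ - pderiv 0 (antideriv 1 v₁)), ?_, ?_⟩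
  · have h' : pderiv 1 (-v₂ - pderiv 0 (antideriv 1 v₁)) = 0 := by
      rw [map_sub, pderiv_comm, pderiv_antideriv, map_neg]
      linear_combination -h
    rw [map_add, pderiv_antideriv, pderiv_antideriv_of_ne (by decide), h', map_zero, add_zero]
  · rw [map_add, pderiv_antideriv]
    ring

theorem totalDegree_le_succ_of_pderiv {σ : Type*} {p : MvPolynomial σ ℝ} {k : ℕ}
    (h : ∀ i, (pderiv i p).totalDegree ≤ k) : p.totalDegree ≤ k + 1 := by
  refine Finset.sup_le fun m hm => ?_
  by_cases hm0 : m = 0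
  · simp [hm0]
  obtain ⟨i, hi⟩ := Finsupp.ne_iff.1 hm0
  obtain ⟨n, rfl⟩ : ∃ n, m = n + Finsupp.single i 1 :=
    ⟨m - Finsupp.single i 1, (tsub_add_cancel_of_le (by
      simpa [Nat.one_le_iff_ne_zero] using hi)).symm⟩
  have hn : n ∈ (pderiv i p).support := by
    rw [mem_support_iff, coeff_pderiv]
    have : (n i + 1 : ℝ) ≠ 0 := by positivity
    exact mul_ne_zero (mem_support_iff.1 hm) this
  have := (le_totalDegree hn).trans (h i)
  rw [Finsupp.sum_add_index' (by simp) (by simp), Finsupp.sum_single_index rfl]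
  omega

theorem derivative_aeval {σ R : Type*} [Fintype σ] [CommRing R] (g : σ → Polynomial R)
    (p : MvPolynomial σ R) :
    Polynomial.derivative (aeval g p) =
      ∑ i, aeval g (pderiv i p) * Polynomial.derivative (g i) := by
  classical
  induction p using MvPolynomial.induction_on with
  | C a => simp
  | add p q hp hq => simp [hp, hq, add_mul, Finset.sum_add_distrib]
  | mul_X p j hp =>
    have h : ∑ i, aeval g p * aeval g (pderiv i (X j : MvPolynomial σ R)) *
        Polynomial.derivative (g i) = aeval g p * Polynomial.derivative (g j) := by
      rw [Finset.sum_eq_single j (fun i _ hi => by simp [pderiv_X_of_ne hi.symm]) (by simp)]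
      simp
    simp only [map_mul, aeval_X, Polynomial.derivative_mul, hp, Derivation.leibniz, smul_eq_mul,
      map_add, add_mul, Finset.sum_add_distrib, Finset.sum_mul, h]
    exact (add_comm _ _).trans (congrArg _ (Finset.sum_congr rfl fun i _ => by ring))

/-- If `g` parametrizes the zero locus of `d`, with polynomial inverse `s`, then a polynomial
vanishing along `g` is divisible by `d`. -/
theorem dvd_of_aeval_eq_zero {σ R : Type*} [CommRing R] {g : σ → Polynomial R}
    {d s : MvPolynomial σ R} (hd : ∀ i, d ∣ X i - Polynomial.aeval s (g i))
    {p : MvPolynomial σ R} (hp : aeval g p = 0) : d ∣ p := by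
  have h : (Ideal.Quotient.mkₐ R (Ideal.span {d})) =
      ((Ideal.Quotient.mkₐ R (Ideal.span {d})).comp (Polynomial.aeval s)).comp (aeval g) := by
    refine algHom_ext fun i => ?_
    simpa [Ideal.Quotient.eq, Ideal.mem_span_singleton] using hd i
  have h' := DFunLike.congr_fun h p
  simpa [hp, Ideal.Quotient.eq_zero_iff_mem, Ideal.mem_span_singleton] using h'

theorem eval_aeval_polynomial {σ R : Type*} [CommRing R] (g : σ → Polynomial R)
    (p : MvPolynomial σ R) (t : R) :
    (aeval g p).eval t = eval (fun i => (g i).eval t) p := by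
  have h : (Polynomial.aeval t).comp (aeval g) =
      (aeval fun i => (g i).eval t : MvPolynomial σ R →ₐ[R] R) :=
    algHom_ext fun i => by simp
  simpa [Polynomial.coe_aeval_eq_eval, aeval_eq_eval] using DFunLike.congr_fun h p

theorem aeval_eq_zero_of_eval_Icc {σ : Type*} {g : σ → Polynomial ℝ} {p : MvPolynomial σ ℝ}
    (h : ∀ t ∈ Set.Icc (0 : ℝ) 1, eval (fun i => (g i).eval t) p = 0) : aeval g p = 0 :=
  Polynomial.eq_zero_of_infinite_isRoot _ <| (Set.Icc_infinite one_pos).mono fun t ht =>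
    (eval_aeval_polynomial g p t).trans (h t ht)

/-- A polynomial whose gradient vanishes along a curve, and which vanishes at one of its points,
vanishes along the curve. -/
theorem aeval_eq_zero_of_pderiv {σ : Type*} [Fintype σ] {g : σ → Polynomial ℝ}
    {p : MvPolynomial σ ℝ} (h : ∀ i, aeval g (pderiv i p) = 0) {t : ℝ}
    (ht : eval (fun i => (g i).eval t) p = 0) : aeval g p = 0 := by
  have hd : Polynomial.derivative (aeval g p) = 0 := by simp [derivative_aeval, h]
  have hc := Polynomial.eq_C_of_natDegree_eq_zero (Polynomial.derivative_eq_zero.1 hd)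
  rw [← eval_aeval_polynomial, hc, Polynomial.eval_C] at ht
  rw [hc, ht, map_zero]

theorem sq_dvd_of_dvd_pderiv {σ R : Type*} [CommRing R] {d p : MvPolynomial σ R} (i : σ)
    (hd : IsUnit (pderiv i d)) (hp : d ∣ p) (hdp : d ∣ pderiv i p) : d ^ 2 ∣ p := by
  obtain ⟨q, rfl⟩ := hp
  rw [Derivation.leibniz, smul_eq_mul, smul_eq_mul, dvd_add_right (dvd_mul_right _ _),
    hd.dvd_mul_right] at hdp
  rw [sq]
  exact mul_dvd_mul_left d hdp

/-- If the gradient of `p` vanishes for `t ∈ [0, 1]` on a curve parametrizing the zero locus of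
`d`, and `p` vanishes at one point of the curve, then `d ^ 2` divides `p`. -/
theorem sq_dvd_of_pderiv_eq_zero {σ : Type*} [Fintype σ] {g : σ → Polynomial ℝ}
    {d s p : MvPolynomial σ ℝ} (hd : ∀ i, d ∣ X i - Polynomial.aeval s (g i))
    {i : σ} (hu : IsUnit (pderiv i d))
    (h : ∀ j, ∀ t ∈ Set.Icc (0 : ℝ) 1, eval (fun l => (g l).eval t) (pderiv j p) = 0) {t : ℝ}
    (ht : eval (fun l => (g l).eval t) p = 0) : d ^ 2 ∣ p :=
  have h' := fun j => aeval_eq_zero_of_eval_Icc (h j)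
  sq_dvd_of_dvd_pderiv i hu (dvd_of_aeval_eq_zero hd (aeval_eq_zero_of_pderiv h' ht))
    (dvd_of_aeval_eq_zero hd (h' i))

end MvPolynomial

theorem bubble_sq_dvd {p : MvPolynomial (Fin 2) ℝ} (h0 : eval ![0, 0] p = 0)
    (h : ∀ x y : ℝ, OnBdryT x y → ∀ i, eval ![x, y] (pderiv i p) = 0) : bubble ^ 2 ∣ p := by
  have hvec : ∀ (a b : Polynomial ℝ) (t : ℝ),
      (fun l => (![a, b] l).eval t) = ![a.eval t, b.eval t] := fun a b t => by
    ext l; fin_cases l <;> rfl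
  have hx : (X 0 : MvPolynomial (Fin 2) ℝ) ^ 2 ∣ p := by
    refine sq_dvd_of_pderiv_eq_zero (g := ![0, Polynomial.X]) (s := X 1) (t := 0) (i := 0)
      (by simp [Fin.forall_fin_two]) (by simp) (fun j t ht => ?_) ?_
    · rw [hvec]
      simpa using h 0 t ⟨le_rfl, ht.1, by linarith [ht.2], by simp⟩ j
    · rw [hvec]; simpa using h0
  have hy : (X 1 : MvPolynomial (Fin 2) ℝ) ^ 2 ∣ p ∧ eval ![1, 0] p = 0 := by
    have hg : ∀ j, ∀ t ∈ Set.Icc (0 : ℝ) 1,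
        eval (fun l => (![Polynomial.X, 0] l : Polynomial ℝ).eval t) (pderiv j p) = 0 := by
      intro j t ht
      rw [hvec]
      simpa using h t 0 ⟨ht.1, le_rfl, by linarith [ht.2], by simp⟩ j
    have hy : (X 1 : MvPolynomial (Fin 2) ℝ) ^ 2 ∣ p := by
      refine sq_dvd_of_pderiv_eq_zero (g := ![Polynomial.X, 0]) (s := X 0) (t := 0) (i := 1)
        (by simp [Fin.forall_fin_two]) (by simp) hg ?_
      rw [hvec]; simpa using h0
    refine ⟨hy, ?_⟩
    obtain ⟨q, rfl⟩ := hy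
    simp
  have hz : (1 - X 0 - X 1 : MvPolynomial (Fin 2) ℝ) ^ 2 ∣ p := by
    refine sq_dvd_of_pderiv_eq_zero (g := ![Polynomial.X, 1 - Polynomial.X]) (s := X 0) (t := 1)
      (i := 0) ?_ (by simp) (fun j t ht => ?_) ?_
    · rw [Fin.forall_fin_two]
      refine ⟨by simp, -1, ?_⟩
      simp
    · rw [hvec]
      simpa using h t (1 - t) ⟨ht.1, by linarith [ht.2], by linarith, by simp⟩ j
    · rw [hvec]; simpa using hy.2
  obtain ⟨q, rfl⟩ := hz
  have hx' : ¬ (X 0 : MvPolynomial (Fin 2) ℝ) ∣ (1 - X 0 - X 1) ^ 2 := by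
    rintro ⟨r, hr⟩
    simpa using congrArg (eval ![0, 0]) hr
  obtain ⟨q, rfl⟩ := X_prime.pow_dvd_of_dvd_mul_left 2 hx' hx
  have hy' : ¬ (X 1 : MvPolynomial (Fin 2) ℝ) ∣ (1 - X 0 - X 1) ^ 2 * X 0 ^ 2 := by
    rintro ⟨r, hr⟩
    have := congrArg (eval ![2, 0]) hr
    norm_num at this
  rw [← mul_assoc] at hy
  obtain ⟨q, rfl⟩ := X_prime.pow_dvd_of_dvd_mul_left 2 hy' hy.1
  exact ⟨q, by rw [bubble]; ring⟩

theorem one_sub_X_sub_X_totalDegree_pos :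
    0 < (1 - X 0 - X 1 : MvPolynomial (Fin 2) ℝ).totalDegree := by
  rw [Nat.pos_iff_ne_zero, Ne, totalDegree_eq_zero_iff_eq_C]
  intro h
  have h' := congrArg (pderiv 0) h
  simp at h'

theorem bubble_ne_zero : bubble ≠ 0 := fun h => by
  have := congrArg (eval ![1, 1]) h
  simp [bubble] at this

theorem three_le_totalDegree_bubble : 3 ≤ bubble.totalDegree := by
  have h := bubble_ne_zero
  have h' := one_sub_X_sub_X_totalDegree_pos
  rw [bubble] at h ⊢
  rw [totalDegree_mul_of_isDomain (left_ne_zero_of_mul h) (right_ne_zero_of_mul h),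
    totalDegree_mul_of_isDomain (X_ne_zero _) (X_ne_zero _), totalDegree_X, totalDegree_X]
  omega

theorem eval_bubble_of_onBdryT {x y : ℝ} (h : OnBdryT x y) : eval ![x, y] bubble = 0 := by
  obtain ⟨-, -, -, rfl | rfl | h⟩ := h
  · simp [bubble]
  · simp [bubble]
  · have : 1 - x - y = 0 := by linarith
    simp [bubble, this]

theorem eval_pderiv_mul_bubble_sq {x y : ℝ} (h : OnBdryT x y) (i : Fin 2)
    (p : MvPolynomial (Fin 2) ℝ) : eval ![x, y] (pderiv i (p * bubble ^ 2)) = 0 := by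
  simp [eval_bubble_of_onBdryT h]

/-- For `k ≥ 5`, a pair of polynomials `(v₁,v₂)` of total degree at most `k` vanishes on
the boundary of the reference triangle and is divergence free (`∂₁v₁ + ∂₂v₂ = 0`) if and
only if `(v₁,v₂) = curl(ψ b²) = (∂₂(ψ b²), −∂₁(ψ b²))` for some polynomial `ψ` of total
degree at most `k − 5`; that is, `Z^k(T̂) = {curl(ψ b²) : ψ ∈ P^{k−5}}`. -/
theorem Zspace_eq_curl (k : ℕ) (hk : 5 ≤ k) (v₁ v₂ : MvPolynomial (Fin 2) ℝ)
    (hv₁ : v₁.totalDegree ≤ k) (hv₂ : v₂.totalDegree ≤ k) :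
    ((∀ x y : ℝ, OnBdryT x y → eval ![x, y] v₁ = 0 ∧ eval ![x, y] v₂ = 0) ∧
        pderiv (0 : Fin 2) v₁ + pderiv (1 : Fin 2) v₂ = 0) ↔
      (∃ ψ : MvPolynomial (Fin 2) ℝ, ψ.totalDegree ≤ k - 5 ∧
        v₁ = pderiv (1 : Fin 2) (ψ * bubble ^ 2) ∧
        v₂ = -pderiv (0 : Fin 2) (ψ * bubble ^ 2)) := by
  constructor
  · rintro ⟨hb, hdiv⟩
    obtain ⟨φ, h₁, h₂⟩ := exists_streamFunction hdiv
    have hdeg : (φ - C (eval ![0, 0] φ)).totalDegree ≤ k + 1 := by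
      refine totalDegree_le_succ_of_pderiv (Fin.forall_fin_two.2 ⟨?_, ?_⟩)
      · simpa [h₂] using hv₂
      · simpa [h₁] using hv₁
    obtain ⟨ψ, hψ⟩ : bubble ^ 2 ∣ φ - C (eval ![0, 0] φ) := by
      refine bubble_sq_dvd (by simp) fun x y hxy => Fin.forall_fin_two.2 ⟨?_, ?_⟩
      · simp [h₂, (hb x y hxy).2]
      · simp [h₁, (hb x y hxy).1]
    refine ⟨ψ, ?_, ?_, ?_⟩
    · rcases eq_or_ne ψ 0 with rfl | h0
      · simp
      have h3 := three_le_totalDegree_bubble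
      rw [hψ, totalDegree_mul_of_isDomain (pow_ne_zero 2 bubble_ne_zero) h0, sq,
        totalDegree_mul_of_isDomain bubble_ne_zero bubble_ne_zero] at hdeg
      omega
    · rw [mul_comm, ← hψ]; simp [h₁]
    · rw [mul_comm, ← hψ]; simp [h₂]
  · rintro ⟨ψ, -, rfl, rfl⟩
    refine ⟨fun x y hxy => ⟨eval_pderiv_mul_bubble_sq hxy 1 ψ, ?_⟩, ?_⟩
    · rw [map_neg, eval_pderiv_mul_bubble_sq hxy 0 ψ, neg_zero]
    · rw [map_neg, pderiv_comm, add_neg_cancel]
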